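/- Let X and Y be configurations of P particles with X ≠ Y. Then det F(X,Y,0) = 0. -/

import Mathlib

open Finset

namespace TASEP

attribute [local instance] Classical.propDecidable

noncomputable section

/-- Generalized binomial coefficient `C(n,k) = n(n-1)⋯(n-k+1)/k!` for `n : ℤ`, `k : ℕ`. -/
def C (n : ℤ) (k : ℕ) : ℝ :=
  (∏ i ∈ Finset.range k, ((n : ℝ) - (i : ℝ))) / (k.factorial : ℝ)

/-- `λ = v/(1-v)`. -/
def lam (v : ℝ) : ℝ := v / (1 - v)

/-- The matrix element `f(a,b,t)` of the determinant solution of the parallel TASEP. -/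
def f (v : ℝ) (a b : ℤ) (t : ℕ) : ℝ :=
  if 1 ≤ a then
    (1 - v) ^ t * (-1 : ℝ) ^ a *
      ∑' k : ℕ, if 0 ≤ b + (k : ℤ) then
        C ((t : ℤ) + a) (b + (k : ℤ)).toNat * C (a + (k : ℤ) - 1) k *
          lam v ^ (b + (k : ℤ)).toNat
      else 0
  else
    (1 - v) ^ t * (-1 : ℝ) ^ a *
      ∑' j : ℕ, if (j : ℤ) ≤ -a ∧ 0 ≤ b + (j : ℤ) then
        (-1 : ℝ) ^ j * C (-a) j * C ((t : ℤ) + a) (b + (j : ℤ)).toNat *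
          lam v ^ (b + (j : ℤ)).toNat
      else 0

/-- Number of pairs of neighboring particles (occupied neighboring sites) in `x`. -/
def nPairs {P : ℕ} (x : Fin P → ℤ) : ℕ :=
  (Finset.univ.filter fun p : Fin P × Fin P =>
    ((p.2 : ℕ) = (p.1 : ℕ) + 1) ∧ x p.2 = x p.1 + 1).card

/-- Number of clusters `N_c(x) = P - nPairs x`. -/
def Nc {P : ℕ} (x : Fin P → ℤ) : ℕ := P - nPairs x

/-- The matrix `F(X,Y,t)` with entries `f(i-j, x_i - y_j, t)`. -/
def Fmat (v : ℝ) {P : ℕ} (x y : Fin P → ℤ) (t : ℕ) : Matrix (Fin P) (Fin P) ℝ :=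
  Matrix.of fun i j => f v ((i : ℤ) - (j : ℤ)) (x i - y j) t

/-- One-step transition probability of the parallel-update TASEP. -/
def Tstep (v : ℝ) {P : ℕ} (x x' : Fin P → ℤ) : ℝ :=
  ∏ i : Fin P,
    if x i = x' i + 1 ∧ (∀ j : Fin P, (j : ℕ) = (i : ℕ) + 1 → x' i + 1 < x' j) then v
    else if x i = x' i ∧ (∀ j : Fin P, (j : ℕ) = (i : ℕ) + 1 → x' i + 1 < x' j) then 1 - v
    else if x i = x' i ∧ (∃ j : Fin P, (j : ℕ) = (i : ℕ) + 1 ∧ x' j = x' i + 1) then 1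
    else 0

/-- Transformed transition probability `T₀(X,X') = (1-v)^(N_c(X)-N_c(X')) T(X,X')`. -/
def T0 (v : ℝ) {P : ℕ} (x x' : Fin P → ℤ) : ℝ :=
  (1 - v) ^ ((Nc x : ℤ) - (Nc x' : ℤ)) * Tstep v x x'

/-- `shiftBy x k` subtracts `1` from the coordinates selected by `k`. -/
def shiftBy {P : ℕ} (x : Fin P → ℤ) (k : Fin P → Bool) : Fin P → ℤ :=
  fun i => x i - if k i then 1 else 0

/-- `t`-step probability of the parallel-update TASEP started from `x0`. -/
def Pt (v : ℝ) {P : ℕ} (x0 : Fin P → ℤ) : ℕ → (Fin P → ℤ) → ℝ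
  | 0 => fun x => if x = x0 then 1 else 0
  | t + 1 => fun x => ∑ k : Fin P → Bool,
      if StrictMono (shiftBy x k) then
        Tstep v x (shiftBy x k) * Pt v x0 t (shiftBy x k)
      else 0

/-- One-particle weight `F₀(x|t)`. -/
def F0 (v : ℝ) (x : ℤ) (t : ℕ) : ℝ :=
  if 0 ≤ x ∧ x ≤ (t : ℤ) then (t.choose x.toNat : ℝ) * v ^ x.toNat * (1 - v) ^ (t - x.toNat)
  else 0

/-- Schütz's functions `F_m(N|t)` for the backward sequential update. -/
def Fm (v : ℝ) (m : ℤ) (N : ℤ) (t : ℕ) : ℝ :=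
  if 0 < m then
    ∑' k : ℕ, ((k + m.toNat - 1).choose (m.toNat - 1) : ℝ) * F0 v (N + (k : ℤ)) t
  else if m = 0 then F0 v N t
  else
    ∑ k ∈ Finset.range (m.natAbs + 1),
      (-1 : ℝ) ^ k * (m.natAbs.choose k : ℝ) * F0 v (N + (k : ℤ)) t

/-- The functions `F̃_m(N|t)` for the parallel update. -/
def Ftil (v : ℝ) (m : ℤ) (N : ℤ) (t : ℕ) : ℝ :=
  if 0 < m then
    ∑ n ∈ Finset.range (m.toNat + 1),
      ∑' k : ℤ, if -(n : ℤ) ≤ k then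
        (m.toNat.choose n : ℝ) * ((m + (n : ℤ) + k - 1).toNat.choose ((n : ℤ) + k).toNat : ℝ) *
          lam v ^ n * F0 v (N + k) t
      else 0
  else if m = 0 then F0 v N t
  else
    ∑ n ∈ Finset.range (m.natAbs + 1),
      ∑' k : ℤ, if -(n : ℤ) ≤ k then
        (-1 : ℝ) ^ n * (m.natAbs.choose n : ℝ) *
          (((m.natAbs : ℤ) + (n : ℤ) + k - 1).toNat.choose ((n : ℤ) + k).toNat : ℝ) *
          (-(lam v)) ^ ((n : ℤ) + k).toNat * F0 v (N - k) t
      else 0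

/-- One-step transition probability of the TASEP with backward sequential update. -/
def TBw (v : ℝ) {P : ℕ} (x x' : Fin P → ℤ) : ℝ :=
  ∏ i : Fin P,
    if h : (i : ℕ) + 1 < P then
      if x' i + 1 < x' ⟨(i : ℕ) + 1, h⟩ ∨
          (x' ⟨(i : ℕ) + 1, h⟩ = x' i + 1 ∧ x ⟨(i : ℕ) + 1, h⟩ = x' ⟨(i : ℕ) + 1, h⟩ + 1) then
        (if x i = x' i + 1 then v else if x i = x' i then 1 - v else 0)
      else if x' ⟨(i : ℕ) + 1, h⟩ = x' i + 1 ∧ x ⟨(i : ℕ) + 1, h⟩ = x' ⟨(i : ℕ) + 1, h⟩ then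
        (if x i = x' i then 1 else 0)
      else 0
    else
      (if x i = x' i + 1 then v else if x i = x' i then 1 - v else 0)

/-- `t`-step probability of the backward-sequential-update TASEP started from `x0`. -/
def Pbw (v : ℝ) {P : ℕ} (x0 : Fin P → ℤ) : ℕ → (Fin P → ℤ) → ℝ
  | 0 => fun x => if x = x0 then 1 else 0
  | t + 1 => fun x => ∑ k : Fin P → Bool,
      if StrictMono (shiftBy x k) then
        TBw v x (shiftBy x k) * Pbw v x0 t (shiftBy x k)
      else 0

/-- Reversed-negated configuration `ι(X)_i = -x_{P+1-i}`. -/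
def iota {P : ℕ} (x : Fin P → ℤ) : Fin P → ℤ := fun i => - x i.rev

/-- `i` is a cluster head of `x` (first particle of a cluster). -/
def isHead {P : ℕ} (x : Fin P → ℤ) (i : Fin P) : Prop :=
  ∀ j : Fin P, (i : ℕ) = (j : ℕ) + 1 → x j + 1 < x i

/-- Position of the `i`-th walker at time `s`, given steps `ε`. -/
def walkerPos {P t : ℕ} (x0 : Fin P → ℤ) (ε : Fin P → Fin t → Bool) (i : Fin P) (s : ℕ) : ℤ :=
  x0 i + ((Finset.univ.filter fun u : Fin t => (u : ℕ) < s ∧ ε i u = true).card : ℤ)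

/-- General Bethe-ansatz sum with amplitudes `A`. -/
def betheSum {P : ℕ} (z : Fin P → ℂ) (A : Equiv.Perm (Fin P) → ℂ) (x : Fin P → ℤ) : ℂ :=
  ∑ σ : Equiv.Perm (Fin P), A σ * ∏ i : Fin P, z (σ i) ^ (-(x i))

/-- `ξ(z) = -(1+λz)/(1-1/z)`. -/
def xiC (v : ℝ) (z : ℂ) : ℂ := -(1 + (lam v : ℂ) * z) / (1 - 1 / z)

/-- Bethe amplitudes `A_σ = sgn(σ) ∏ ξ_{σ(i)}^{i-σ(i)}`. -/
def ampA (v : ℝ) {P : ℕ} (z : Fin P → ℂ) (σ : Equiv.Perm (Fin P)) : ℂ :=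
  ((Equiv.Perm.sign σ : ℤ) : ℂ) * ∏ i : Fin P, xiC v (z (σ i)) ^ ((i : ℤ) - (σ i : ℤ))

/-- The Bethe eigenfunction `B(x)`. -/
def betheB (v : ℝ) {P : ℕ} (z : Fin P → ℂ) (x : Fin P → ℤ) : ℂ :=
  betheSum z (ampA v z) x


/-- The binomial coefficient `C(n,k)` vanishes for `0 ≤ n < k`. -/
lemma C_eq_zero_of_lt {n : ℤ} {k : ℕ} (hn : 0 ≤ n) (hnk : n < k) : C n k = 0 := by
  lift n to ℕ using hn
  have hmem : n ∈ Finset.range k := by simpa using hnk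
  unfold C
  rw [Finset.prod_eq_zero hmem (by simp), zero_div]

lemma f_zero_eq_zero_of_lt (v : ℝ) {a b : ℤ} (ha : 0 ≤ a) (hab : a < b) : f v a b 0 = 0 := by
  have hC (k : ℕ) : C (((0 : ℕ) : ℤ) + a) (b + (k : ℤ)).toNat = 0 :=
    C_eq_zero_of_lt (by omega) (by omega)
  simp only [f, hC, mul_zero, zero_mul, ite_self, tsum_zero]

lemma f_zero_eq_zero_of_gt (v : ℝ) {a b : ℤ} (ha : a ≤ 0) (hab : b < a) : f v a b 0 = 0 := by
  have hcond (j : ℕ) : ¬((j : ℤ) ≤ -a ∧ 0 ≤ b + (j : ℤ)) := by omega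
  simp only [f, if_neg (show ¬1 ≤ a by omega), hcond, if_false, tsum_zero, mul_zero]

/-- A matrix with an `S × T` block of zeros, where `|S| + |T|` exceeds the size of the matrix,
has determinant zero. -/
lemma det_eq_zero_of_zero_block {n R : Type*} [Fintype n] [DecidableEq n] [CommRing R]
    (M : Matrix n n R) (S T : Finset n) (hcard : Fintype.card n < S.card + T.card)
    (hM : ∀ i ∈ S, ∀ j ∈ T, M i j = 0) : M.det = 0 := by
  rw [Matrix.det_apply]
  refine Finset.sum_eq_zero fun σ _ => ?_
  have hσ : ∃ j ∈ T, σ j ∈ S := by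
    by_contra! h
    have hdisj : Disjoint S (T.map σ.toEmbedding) := by
      rw [Finset.disjoint_right]
      intro i hi
      obtain ⟨j, hj, rfl⟩ := Finset.mem_map.mp hi
      exact h j hj
    have hle := Finset.card_le_univ (S.disjUnion _ hdisj)
    rw [Finset.card_disjUnion, Finset.card_map] at hle
    omega
  obtain ⟨j, hj, hjS⟩ := hσ
  have hprod : ∏ i, M (σ i) i = 0 := Finset.prod_eq_zero (Finset.mem_univ j) (hM _ hjS _ hj)
  rw [hprod, smul_zero]

/-- For a strictly increasing configuration, `i ↦ x i - i` is weakly increasing. -/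
lemma monotone_sub_index {P : ℕ} {x : Fin P → ℤ} (hx : StrictMono x) :
    Monotone fun i : Fin P => x i - (i : ℤ) := by
  have key (d : ℕ) : ∀ i j : Fin P, (j : ℕ) = i + d → x i + d ≤ x j := by
    induction d with
    | zero =>
      intro i j h
      simp [Fin.ext (a := j) (b := i) h]
    | succ d ih =>
      intro i j h
      have hlt : (i : ℕ) + d < P := by omega
      have h₁ := ih i ⟨i + d, hlt⟩ rfl
      have h₂ : x ⟨i + d, hlt⟩ < x j := hx (by rw [Fin.lt_def]; simp; omega)
      push_cast
      omega
  intro i j hij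
  have hij' : (i : ℕ) ≤ j := hij
  have := key (j - i) i j (by omega)
  simp only
  omega

/-- If `X ≠ Y` then `det F(X,Y,0) = 0`. -/
theorem detF_zero_of_ne
    (v : ℝ) (hv0 : 0 < v) (hv1 : v < 1) (P : ℕ) (hP : 1 ≤ P)
    (x y : Fin P → ℤ) (hx : StrictMono x) (hy : StrictMono y) (hxy : x ≠ y) :
    (Fmat v x y 0).det = 0 := by
  have hu := monotone_sub_index hx
  have hw := monotone_sub_index hy
  obtain ⟨s, hs⟩ := Function.ne_iff.mp hxy
  rcases lt_or_gt_of_ne hs with hlt | hgt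
  · refine det_eq_zero_of_zero_block _ (Finset.Iic s) (Finset.Ici s) ?_ fun i hi j hj => ?_
    · simp only [Fintype.card_fin, Fin.card_Iic, Fin.card_Ici]
      omega
    · rw [Finset.mem_Iic] at hi
      rw [Finset.mem_Ici] at hj
      have h₁ := hu hi
      have h₂ := hw hj
      rw [Fin.le_def] at hi hj
      simp only at h₁ h₂
      exact f_zero_eq_zero_of_gt v (by omega) (by omega)
  · refine det_eq_zero_of_zero_block _ (Finset.Ici s) (Finset.Iic s) ?_ fun i hi j hj => ?_
    · simp only [Fintype.card_fin, Fin.card_Iic, Fin.card_Ici]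
      omega
    · rw [Finset.mem_Ici] at hi
      rw [Finset.mem_Iic] at hj
      have h₁ := hu hi
      have h₂ := hw hj
      rw [Fin.le_def] at hi hj
      simp only at h₁ h₂
      exact f_zero_eq_zero_of_lt v (by omega) (by omega)

end

end TASEP
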